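/- There do not exist real numbers a_{10}, a_{20}, a_{21}, a_{30}, a_{31}, a_{32}, b_0, b_1, b_2, b_3, all strictly positive, satisfying the fourth-order conditions for a 4-stage explicit Runge–Kutta method: with c_1 = a_{10}, c_2 = a_{20} + a_{21}, c_3 = a_{30} + a_{31} + a_{32}, one has b_0 + b_1 + b_2 + b_3 = 1; b_1 c_1 + b_2 c_2 + b_3 c_3 = 1/2; b_1 c_1² + b_2 c_2² + b_3 c_3² = 1/3; b_1 c_1³ + b_2 c_2³ + b_3 c_3³ = 1/4; b_2 a_{21} c_1 + b_3 (a_{31} c_1 + a_{32} c_2) = 1/6; b_2 c_2 a_{21} c_1 + b_3 c_3 (a_{31} c_1 + a_{32} c_2) = 1/8; b_2 a_{21} c_1² + b_3 (a_{31} c_1² + a_{32} c_2²) = 1/12; and b_3 a_{32} a_{21} c_1 = 1/24. (Consequently, no 4-stage fourth-order explicit Runge–Kutta method satisfies the RK-SSP condition.) -/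

import Mathlib

/-- The row vector `(d₁, d₂, d₃)` annihilates the columns `c`, `c²` and `y`. If two weight vectors
`b` and `b c` annihilate `y` and have the moments of a fourth-order quadrature on `c`, `c²`, then
these columns are independent and the row vanishes. -/
theorem row_eq_zero_of_quadrature {b1 b2 b3 c1 c2 c3 y1 y2 y3 d1 d2 d3 : ℝ} (hy1 : y1 ≠ 0)
    (h1 : b1 * c1 + b2 * c2 + b3 * c3 = 1 / 2)
    (h2 : b1 * c1 ^ 2 + b2 * c2 ^ 2 + b3 * c3 ^ 2 = 1 / 3)
    (h3 : b1 * c1 ^ 3 + b2 * c2 ^ 3 + b3 * c3 ^ 3 = 1 / 4)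
    (hb : b1 * y1 + b2 * y2 + b3 * y3 = 0)
    (hbc : b1 * c1 * y1 + b2 * c2 * y2 + b3 * c3 * y3 = 0)
    (hd1 : d1 * c1 + d2 * c2 + d3 * c3 = 0)
    (hd2 : d1 * c1 ^ 2 + d2 * c2 ^ 2 + d3 * c3 ^ 2 = 0)
    (hdy : d1 * y1 + d2 * y2 + d3 * y3 = 0) :
    d1 = 0 ∧ d2 = 0 ∧ d3 = 0 := by
  set M : Matrix (Fin 3) (Fin 3) ℝ := !![c1, c1 ^ 2, y1; c2, c2 ^ 2, y2; c3, c3 ^ 2, y3] with hM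
  have hprod : !![b1, b2, b3; b1 * c1, b2 * c2, b3 * c3; 1, 0, 0] * M =
      !![1 / 2, 1 / 3, 0; 1 / 3, 1 / 4, 0; c1, c1 ^ 2, y1] := by
    ext i j
    fin_cases i <;> fin_cases j <;> simp [hM, Matrix.mul_apply, Fin.sum_univ_three] <;> linarith
  have hdet : M.det ≠ 0 := by
    intro h
    have h' := congrArg Matrix.det hprod
    rw [Matrix.det_mul, h, mul_zero, Matrix.det_fin_three] at h'
    simp at h'
    exact hy1 (by linarith)
  have hd : Matrix.vecMul ![d1, d2, d3] M = 0 := by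
    ext j
    fin_cases j <;> simp [hM, Matrix.vecMul, dotProduct, Fin.sum_univ_three] <;> linarith
  have h0 := Matrix.eq_zero_of_vecMul_eq_zero hdet hd
  exact ⟨congrFun h0 0, congrFun h0 1, congrFun h0 2⟩

/-- The numerator of `a30` in the two-parameter family of fourth-order methods is negative
when the abscissae satisfy `0 < v < 1 / 2 < u < 1`. -/
theorem a30_numerator_neg {u v : ℝ} (hu : 0 < u - 1 / 2) (hu1 : 0 < 1 - u) (hv : 0 < v)
    (hv1 : 0 < 1 / 2 - v) :
    12 * u ^ 2 * v ^ 2 - 12 * u ^ 2 * v - 12 * u * v ^ 2 + 15 * u * v + 4 * u ^ 2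
      + 4 * v ^ 2 - 5 * v - 6 * u + 2 < 0 := by
  have hpq : 0 < (u - 1 / 2) * (1 / 2 - v) := mul_pos hu hv1
  have hpq4 : 0 < 1 / 4 - (u - 1 / 2) * (1 / 2 - v) := by
    linarith [mul_pos hu hv, mul_pos hu1 hv]
  linarith [mul_pos hu hu1, mul_pos hv1 hv, mul_pos hpq hpq4]

/-- There is no 4-stage fourth-order explicit Runge–Kutta method
all of whose Butcher coefficients `a_{ik}` and weights `b_k` are strictly
positive: the eight fourth-order order conditions are incompatible with
positivity of all coefficients. -/
theorem no_positive_4stage_4th_order_rk :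
    ¬ ∃ a10 a20 a21 a30 a31 a32 b0 b1 b2 b3 : ℝ,
      0 < a10 ∧ 0 < a20 ∧ 0 < a21 ∧ 0 < a30 ∧ 0 < a31 ∧ 0 < a32 ∧
      0 < b0 ∧ 0 < b1 ∧ 0 < b2 ∧ 0 < b3 ∧
      (let c1 := a10
       let c2 := a20 + a21
       let c3 := a30 + a31 + a32
       b0 + b1 + b2 + b3 = 1 ∧
       b1 * c1 + b2 * c2 + b3 * c3 = 1 / 2 ∧
       b1 * c1 ^ 2 + b2 * c2 ^ 2 + b3 * c3 ^ 2 = 1 / 3 ∧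
       b1 * c1 ^ 3 + b2 * c2 ^ 3 + b3 * c3 ^ 3 = 1 / 4 ∧
       b2 * a21 * c1 + b3 * (a31 * c1 + a32 * c2) = 1 / 6 ∧
       b2 * c2 * a21 * c1 + b3 * c3 * (a31 * c1 + a32 * c2) = 1 / 8 ∧
       b2 * a21 * c1 ^ 2 + b3 * (a31 * c1 ^ 2 + a32 * c2 ^ 2) = 1 / 12 ∧
       b3 * a32 * a21 * c1 = 1 / 24) := by
  rintro ⟨u, a20, a21, a30, a31, a32, b0, b1, b2, b3, hu, ha20, ha21, ha30, ha31, ha32,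
    -, hb1, hb2, hb3, -, e1, e2, e3, e4, e5, e6, e7⟩
  obtain ⟨v, hv⟩ : ∃ v, v = a20 + a21 := ⟨_, rfl⟩
  obtain ⟨w, hw⟩ : ∃ w, w = a30 + a31 + a32 := ⟨_, rfl⟩
  simp only [← hv, ← hw] at e1 e2 e3 e4 e5 e6
  have hv0 : 0 < v := by linarith
  obtain ⟨s1, s2, s3⟩ := row_eq_zero_of_quadrature
    (y1 := -u ^ 2 / 2) (y2 := a21 * u - v ^ 2 / 2) (y3 := a31 * u + a32 * v - w ^ 2 / 2)
    (d1 := b2 * a21 + b3 * a31 - b1 * (1 - u)) (d2 := b3 * a32 - b2 * (1 - v))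
    (d3 := -(b3 * (1 - w))) (by have := pow_pos hu 2; intro h; linarith) e1 e2 e3
    (by linarith) (by linarith) (by linarith) (by linarith) (by linarith)
  have hw1 : w = 1 := by
    have : b3 * (1 - w) = 0 := by linarith
    rcases mul_eq_zero.1 this with h | h <;> linarith
  subst hw1
  have hv1 : 0 < 1 - v := by
    have : 0 < b2 * (1 - v) := by linarith [mul_pos hb3 ha32]
    exact (mul_pos_iff_of_pos_left hb2).1 this
  have hu1 : 0 < 1 - u := by
    have : 0 < b1 * (1 - u) := by linarith [mul_pos hb3 ha31, mul_pos hb2 ha21]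
    exact (mul_pos_iff_of_pos_left hb1).1 this
  have hB1 : 12 * u * (1 - u) * b1 * (v - u) = 2 * v - 1 := by
    linear_combination 12 * e3 - 12 * (1 + v) * e2 + 12 * v * e1
  have hB2 : 12 * v * (1 - v) * b2 * (v - u) = 1 - 2 * u := by
    linear_combination -12 * e3 + 12 * (1 + u) * e2 - 12 * u * e1
  have hB3 : 12 * (1 - u) * (1 - v) * b3 = 6 * u * v - 4 * u - 4 * v + 3 := by
    linear_combination 12 * e3 - 12 * (u + v) * e2 + 12 * u * v * e1
  have hA : 24 * u * (1 - v) * b2 * a21 = 1 := by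
    linear_combination 24 * e7 - 24 * a21 * u * s2
  have hb3a30 : b3 * a30 = b3 - b2 * (1 - v) - b1 * (1 - u) + b2 * a21 := by
    linear_combination -b3 * hw - s1 - s2
  rcases lt_trichotomy u v with huv | huv | huv
  · have hk : 0 < 24 * u * (1 - v) * (v - u) := by
      have := sub_pos.2 huv
      positivity
    have hA31 : 24 * u * (1 - v) * (v - u) * (b3 * a31) = u + 5 * v - 4 * v ^ 2 - 2 := by
      linear_combination 24 * u * (1 - v) * (v - u) * s1 + 2 * (1 - v) * hB1 - (v - u) * hA
    have hA20 : 24 * u * (1 - v) * (v - u) * (b2 * a20) = 2 * u * (1 - 2 * u) - (v - u) := by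
      linear_combination 2 * u * hB2 - (v - u) * hA - 24 * u * (1 - v) * (v - u) * b2 * hv
    have p1 := mul_pos hk (mul_pos hb3 ha31)
    have p2 := mul_pos hk (mul_pos hb2 ha20)
    linarith [sq_nonneg (u - 1 / 2), sq_nonneg (v - 1 / 2)]
  · have hv2 : v = 1 / 2 := by rw [huv] at hB1; linarith
    have hu2 : u = 1 / 2 := by linarith
    subst hu2 hv2
    have : b3 * a30 = 0 := by linarith
    linarith [mul_pos hb3 ha30]
  · have hp : 0 < u - 1 / 2 := by
      have : 0 < 12 * v * (1 - v) * b2 * (u - v) := by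
        have := sub_pos.2 huv
        positivity
      linarith
    have hq : 0 < 1 / 2 - v := by
      have : 0 < 12 * u * (1 - u) * b1 * (u - v) := by
        have := sub_pos.2 huv
        positivity
      linarith
    have hA30 : 24 * u * v * (1 - u) * (1 - v) * (b3 * a30) =
        12 * u ^ 2 * v ^ 2 - 12 * u ^ 2 * v - 12 * u * v ^ 2 + 15 * u * v + 4 * u ^ 2
          + 4 * v ^ 2 - 5 * v - 6 * u + 2 := by
      apply mul_right_cancel₀ (sub_ne_zero.2 huv.ne)
      rw [hb3a30]
      linear_combination 2 * u * v * (v - u) * hB3 - 2 * u * (1 - u) * (1 - v) * hB2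
        - 2 * v * (1 - u) * (1 - v) * hB1 + v * (1 - u) * (v - u) * hA
    have p1 : 0 < 24 * u * v * (1 - u) * (1 - v) * (b3 * a30) := by positivity
    linarith [a30_numerator_neg hp (by linarith) (by linarith) hq]
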